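/- arXiv:1703.10367 — 2 statements merged into one kernel-verified Lean document; each statement's English description precedes it below -/
import Mathlib

section
/- Let σ be a distortion function, X a Banach space and p ∈ [1,∞). For every strongly measurable Y : Ω → X and every U ∈ 𝒰(0,1) that is coupled in a comonotone way with ‖Y‖, i.e., (U(ω)−U(ω'))·(‖Y(ω)‖−‖Y(ω')‖) ≥ 0 for P⊗P-almost every (ω,ω'), one has ‖Y‖_{σ,p}^p = E[σ(U)·‖Y‖^p] = ∫₀¹ σ(u)·F_{‖Y‖}^{-1}(u)^p du. -/
open MeasureTheory
open scoped ENNReal NNReal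

noncomputable section

variable {Ω : Type*} [MeasurableSpace Ω]

/-- A `[0,1]`-valued random variable uniformly distributed on `[0,1]`:
`P(U ≤ u) = u` for all `u ∈ [0,1]`. -/
def IsUniformRV (P : Measure Ω) (U : Ω → ℝ) : Prop :=
  Measurable U ∧ (∀ ω, U ω ∈ Set.Icc (0 : ℝ) 1) ∧
    ∀ u ∈ Set.Icc (0 : ℝ) 1, P {ω | U ω ≤ u} = ENNReal.ofReal u

/-- A distortion function: nondecreasing, nonnegative, left-continuous on `[0,1)`
with `∫₀¹ σ(u) du = 1`. -/
structure IsDistortion (σ : ℝ → ℝ) : Prop where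
  nonneg : ∀ u ∈ Set.Ico (0 : ℝ) 1, 0 ≤ σ u
  mono : MonotoneOn σ (Set.Ico (0 : ℝ) 1)
  left_continuous : ∀ u ∈ Set.Ioo (0 : ℝ) 1,
    Filter.Tendsto σ (nhdsWithin u (Set.Iio u)) (nhds (σ u))
  integral_one : ∫ u in Set.Ioo (0 : ℝ) 1, σ u = 1

/-- `‖Y‖_{σ,p}^p := sup over uniform U of E[σ(U)·‖Y‖^p]`. -/
def sigmaPow (P : Measure Ω) (σ : ℝ → ℝ) (p : ℝ) {X : Type*} [NormedAddCommGroup X]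
    (Y : Ω → X) : ℝ≥0∞ :=
  ⨆ (U : Ω → ℝ) (_ : IsUniformRV P U),
    ∫⁻ ω, ENNReal.ofReal (σ (U ω)) * (‖Y ω‖₊ : ℝ≥0∞) ^ p ∂P

/-- The norm `‖Y‖_{σ,p}`. -/
def sigmaNorm (P : Measure Ω) (σ : ℝ → ℝ) (p : ℝ) {X : Type*} [NormedAddCommGroup X]
    (Y : Ω → X) : ℝ≥0∞ :=
  sigmaPow P σ p Y ^ (1 / p)

/-- Membership in `L_σ^p(P,X)`: strongly measurable with finite `σ,p`-norm. -/
def MemLsigma (P : Measure Ω) (σ : ℝ → ℝ) (p : ℝ) {X : Type*} [NormedAddCommGroup X]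
    (Y : Ω → X) : Prop :=
  AEStronglyMeasurable Y P ∧ sigmaPow P σ p Y < ∞

/-- The generalized inverse distribution function (quantile function)
`F_g^{-1}(α) = inf {q : P(g ≤ q) ≥ α}`. -/
def quantileFn (P : Measure Ω) (g : Ω → ℝ) (α : ℝ) : ℝ :=
  sInf {q : ℝ | ENNReal.ofReal α ≤ P {ω | g ω ≤ q}}

/-- Two-dimensional layer cake formula. -/
lemma lintegral_ofReal_mul_ofReal {α : Type*} [MeasurableSpace α] (μ : Measure α)
    [IsFiniteMeasure μ] {a b : α → ℝ} (ha : AEMeasurable a μ) (hb : AEMeasurable b μ)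
    (ha0 : 0 ≤ᵐ[μ] a) (hb0 : 0 ≤ᵐ[μ] b) :
    ∫⁻ x, ENNReal.ofReal (a x) * ENNReal.ofReal (b x) ∂μ
      = ∫⁻ s in Set.Ioi 0, ∫⁻ t in Set.Ioi 0, μ ({x | t < b x} ∩ {x | s < a x}) := by
  have hac := withDensity_absolutelyContinuous μ (fun x => ENNReal.ofReal (b x))
  calc ∫⁻ x, ENNReal.ofReal (a x) * ENNReal.ofReal (b x) ∂μ
      = ∫⁻ x, ENNReal.ofReal (a x) ∂μ.withDensity (fun x => ENNReal.ofReal (b x)) := by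
        rw [lintegral_withDensity_eq_lintegral_mul₀ hb.ennreal_ofReal ha.ennreal_ofReal]
        simp [mul_comm]
    _ = ∫⁻ s in Set.Ioi 0, μ.withDensity (fun x => ENNReal.ofReal (b x)) {x | s < a x} :=
        lintegral_eq_lintegral_meas_lt _ (hac.ae_le ha0) (ha.mono_ac hac)
    _ = _ := by
        refine lintegral_congr fun s => ?_
        rw [withDensity_apply', lintegral_eq_lintegral_meas_lt _ (ae_restrict_of_ae hb0) hb.restrict]
        refine lintegral_congr fun t => ?_
        exact Measure.restrict_apply₀ (nullMeasurableSet_lt aemeasurable_const hb.restrict)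

/-- Among couplings with prescribed marginals, a comonotone one maximizes `E[a * b]`. -/
lemma lintegral_ofReal_mul_le_of_comonotone {α β : Type*} [MeasurableSpace α] [MeasurableSpace β]
    {μ : Measure α} {ν : Measure β} [IsFiniteMeasure μ] [IsFiniteMeasure ν]
    {a b : α → ℝ} {a' b' : β → ℝ}
    (ha : ProbabilityTheory.IdentDistrib a a' μ ν) (hb : ProbabilityTheory.IdentDistrib b b' μ ν)
    (ha0 : 0 ≤ᵐ[μ] a) (hb0 : 0 ≤ᵐ[μ] b)
    (hcom : ∀ᵐ z ∂(ν.prod ν), ¬(a' z.1 < a' z.2 ∧ b' z.2 < b' z.1)) :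
    ∫⁻ x, ENNReal.ofReal (a x) * ENNReal.ofReal (b x) ∂μ
      ≤ ∫⁻ y, ENNReal.ofReal (a' y) * ENNReal.ofReal (b' y) ∂ν := by
  have ha0' : 0 ≤ᵐ[ν] a' := ha.ae_snd (measurableSet_Ici (a := (0 : ℝ))) ha0
  have hb0' : 0 ≤ᵐ[ν] b' := hb.ae_snd (measurableSet_Ici (a := (0 : ℝ))) hb0
  rw [lintegral_ofReal_mul_ofReal μ ha.aemeasurable_fst hb.aemeasurable_fst ha0 hb0,
    lintegral_ofReal_mul_ofReal ν ha.aemeasurable_snd hb.aemeasurable_snd ha0' hb0']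
  refine lintegral_mono fun s => lintegral_mono fun t => ?_
  have hA : μ {x | s < a x} = ν {y | s < a' y} := ha.measure_mem_eq measurableSet_Ioi
  have hB : μ {x | t < b x} = ν {y | t < b' y} := hb.measure_mem_eq measurableSet_Ioi
  have hnull : ν ({y | t < b' y} \ {y | s < a' y}) * ν ({y | s < a' y} \ {y | t < b' y}) = 0 := by
    rw [← Measure.prod_prod]
    refine measure_mono_null ?_ (ae_iff.1 hcom)
    rintro ⟨x, y⟩ ⟨⟨h1, h2⟩, h3, h4⟩
    simp only [Set.mem_ofPred_eq, not_lt, not_not] at *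
    exact ⟨h2.trans_lt h3, h4.trans_lt h1⟩
  rcases mul_eq_zero.1 hnull with h | h
  · calc _ ≤ μ {x | t < b x} := measure_mono Set.inter_subset_left
      _ ≤ _ := by
        rw [hB]
        simpa [h] using measure_le_inter_add_sdiff ν {y | t < b' y} {y | s < a' y}
  · calc _ ≤ μ {x | s < a x} := measure_mono Set.inter_subset_right
      _ ≤ _ := by
        rw [hA, Set.inter_comm]
        simpa [h] using measure_le_inter_add_sdiff ν {y | s < a' y} {y | t < b' y}

/-- Galois connection between the quantile function and the distribution function. -/
lemma quantileFn_le_iff {P : Measure Ω} [IsProbabilityMeasure P] {g : Ω → ℝ}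
    (hg : AEMeasurable g P) {u : ℝ} (hu : u ∈ Set.Ioo (0 : ℝ) 1) (q : ℝ) :
    quantileFn P g u ≤ q ↔ ENNReal.ofReal u ≤ P {ω | g ω ≤ q} := by
  have := Measure.isProbabilityMeasure_map hg
  have hF : ∀ r, ENNReal.ofReal u ≤ P {ω | g ω ≤ r} ↔ u ≤ ProbabilityTheory.cdf (P.map g) r := by
    intro r
    have h : P {ω | g ω ≤ r} = ENNReal.ofReal (ProbabilityTheory.cdf (P.map g) r) := by
      rw [ProbabilityTheory.ofReal_cdf, Measure.map_apply_of_aemeasurable hg measurableSet_Iic]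
      rfl
    rw [h, ENNReal.ofReal_le_ofReal_iff (ProbabilityTheory.cdf_nonneg _ _)]
  simp only [quantileFn, hF]
  have hne : {r | u ≤ ProbabilityTheory.cdf (P.map g) r}.Nonempty :=
    ((ProbabilityTheory.tendsto_cdf_atTop (P.map g)).eventually_const_le hu.2).exists
  have hbdd : BddBelow {r | u ≤ ProbabilityTheory.cdf (P.map g) r} := by
    obtain ⟨m, hm⟩ := ((ProbabilityTheory.tendsto_cdf_atBot (P.map g)).eventually_lt_const
      hu.1).exists
    refine ⟨m, fun r hr => ?_⟩
    by_contra! h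
    exact absurd (hr.trans (ProbabilityTheory.monotone_cdf _ h.le)) hm.not_ge
  refine ⟨fun h => ?_, fun h => csInf_le hbdd h⟩
  refine ge_of_tendsto (((ProbabilityTheory.cdf (P.map g)).right_continuous q).mono
    Set.Ioi_subset_Ici_self) ?_
  filter_upwards [self_mem_nhdsWithin] with r hr
  obtain ⟨s, hs, hsr⟩ := exists_lt_of_csInf_lt hne (h.trans_lt hr)
  exact hs.trans (ProbabilityTheory.monotone_cdf _ hsr.le)

lemma quantileFn_monotoneOn {P : Measure Ω} [IsProbabilityMeasure P] {g : Ω → ℝ}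
    (hg : AEMeasurable g P) : MonotoneOn (quantileFn P g) (Set.Ioo 0 1) := fun _ hu _ hv huv =>
  (quantileFn_le_iff hg hu _).2
    ((ENNReal.ofReal_le_ofReal huv).trans ((quantileFn_le_iff hg hv _).1 le_rfl))

instance : IsProbabilityMeasure (volume.restrict (Set.Ioo (0 : ℝ) 1)) := ⟨by simp⟩

lemma volume_restrict_Ioo_Iic {c : ℝ} (h1 : c ≤ 1) :
    (volume.restrict (Set.Ioo (0 : ℝ) 1)) (Set.Iic c) = ENNReal.ofReal c := by
  rw [Measure.restrict_congr_set Ioo_ae_eq_Ioc, Measure.restrict_apply measurableSet_Iic]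
  have : Set.Iic c ∩ Set.Ioc 0 1 = Set.Ioc 0 c := by
    ext x
    simp only [Set.mem_inter_iff, Set.mem_Iic, Set.mem_Ioc]
    exact ⟨fun h => ⟨h.2.1, h.1⟩, fun h => ⟨h.2, h.1, h.2.trans h1⟩⟩
  simp [this]

/-- The quantile function, seen as a random variable on `(0,1)`, has the law of `g`. -/
lemma identDistrib_quantileFn {P : Measure Ω} [IsProbabilityMeasure P] {g : Ω → ℝ}
    (hg : AEMeasurable g P) :
    ProbabilityTheory.IdentDistrib g (quantileFn P g) P (volume.restrict (Set.Ioo 0 1)) := by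
  have hQ := aemeasurable_restrict_of_monotoneOn (μ := volume) measurableSet_Ioo
    (quantileFn_monotoneOn hg)
  refine ⟨hg, hQ, Measure.ext_of_Iic _ _ fun q => ?_⟩
  rw [Measure.map_apply_of_aemeasurable hg measurableSet_Iic,
    Measure.map_apply_of_aemeasurable hQ measurableSet_Iic]
  have hle : P {ω | g ω ≤ q} ≤ 1 := prob_le_one
  have hev : quantileFn P g ⁻¹' Set.Iic q =ᵐ[volume.restrict (Set.Ioo (0 : ℝ) 1)]
      Set.Iic (P {ω | g ω ≤ q}).toReal := by
    filter_upwards [ae_restrict_mem measurableSet_Ioo] with u hu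
    refine propext ((quantileFn_le_iff hg hu q).trans ?_)
    exact ENNReal.ofReal_le_iff_le_toReal (measure_ne_top _ _)
  rw [measure_congr hev, volume_restrict_Ioo_Iic
    (ENNReal.toReal_le_of_le_ofReal zero_le_one (by simpa using hle)),
    ENNReal.ofReal_toReal (measure_ne_top _ _)]
  rfl

lemma IsUniformRV.identDistrib_id {P : Measure Ω} [IsProbabilityMeasure P] {U : Ω → ℝ}
    (hU : IsUniformRV P U) :
    ProbabilityTheory.IdentDistrib U id P (volume.restrict (Set.Ioo 0 1)) := by
  obtain ⟨hm, hmem, hlaw⟩ := hU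
  refine ⟨hm.aemeasurable, aemeasurable_id, ?_⟩
  rw [Measure.map_id]
  have := Measure.isProbabilityMeasure_map (μ := P) hm.aemeasurable
  refine Measure.ext_of_Iic _ _ fun q => ?_
  rw [Measure.map_apply hm measurableSet_Iic]
  rcases lt_or_ge q 0 with h0 | h0
  · rw [Measure.restrict_apply measurableSet_Iic]
    have h1 : U ⁻¹' Set.Iic q = ∅ := by
      ext ω
      simpa using h0.trans_le (hmem ω).1
    have h2 : Set.Iic q ∩ Set.Ioo 0 1 = ∅ := by
      ext x
      simp only [Set.mem_inter_iff, Set.mem_Iic, Set.mem_Ioo, Set.mem_empty_iff_false, iff_false]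
      rintro ⟨h, h', -⟩
      linarith
    simp [h1, h2]
  rcases le_or_gt q 1 with h1 | h1
  · rw [volume_restrict_Ioo_Iic h1]
    exact hlaw q ⟨h0, h1⟩
  · have h2 : U ⁻¹' Set.Iic q = Set.univ := by
      ext ω
      simpa using (hmem ω).2.trans h1.le
    have h3 : Set.Ioo 0 1 ⊆ Set.Iic q := fun x hx => (hx.2.trans h1).le
    rw [h2, measure_univ, Measure.restrict_apply measurableSet_Iic,
      Set.inter_eq_right.2 h3]
    simp

lemma IsUniformRV.ae_mem_Ioo {P : Measure Ω} [IsProbabilityMeasure P] {U : Ω → ℝ}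
    (hU : IsUniformRV P U) : ∀ᵐ ω ∂P, U ω ∈ Set.Ioo (0 : ℝ) 1 :=
  hU.identDistrib_id.symm.ae_snd measurableSet_Ioo (ae_restrict_mem measurableSet_Ioo)

lemma quantileFn_nonneg {P : Measure Ω} {g : Ω → ℝ} (hg : ∀ ω, 0 ≤ g ω) {u : ℝ} (hu : 0 < u) :
    0 ≤ quantileFn P g u := by
  refine Real.sInf_nonneg fun q hq => ?_
  by_contra! h
  have h0 : {ω | g ω ≤ q} = ∅ := by
    ext ω
    simpa using h.trans_le (hg ω)
  simp only [Set.mem_ofPred_eq, h0, measure_empty, nonpos_iff_eq_zero, ENNReal.ofReal_eq_zero] at hq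
  exact hq.not_gt hu

/-- For every strongly measurable `Y : Ω → X` and every uniform `U`
coupled in a comonotone way with `‖Y‖`, one has
`‖Y‖_{σ,p}^p = E[σ(U)·‖Y‖^p] = ∫₀¹ σ(u)·F_{‖Y‖}^{-1}(u)^p du`. -/
theorem statement0
    (P : Measure Ω) [IsProbabilityMeasure P]
    {X : Type*} [NormedAddCommGroup X]
    (σ : ℝ → ℝ) (hσ : IsDistortion σ) (p : ℝ) (hp : 1 ≤ p)
    (Y : Ω → X) (hY : AEStronglyMeasurable Y P)
    (U : Ω → ℝ) (hU : IsUniformRV P U)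
    (hcom : ∀ᵐ z ∂(P.prod P), 0 ≤ (U z.1 - U z.2) * (‖Y z.1‖ - ‖Y z.2‖)) :
    sigmaPow P σ p Y = ∫⁻ ω, ENNReal.ofReal (σ (U ω)) * (‖Y ω‖₊ : ℝ≥0∞) ^ p ∂P ∧
    sigmaPow P σ p Y
      = ∫⁻ u in Set.Ioo (0 : ℝ) 1,
          ENNReal.ofReal (σ u) * ENNReal.ofReal (quantileFn P (fun ω => ‖Y ω‖) u) ^ p := by
  have hp0 : 0 ≤ p := zero_le_one.trans hp
  have hσ' : MonotoneOn σ (Set.Ioo 0 1) := hσ.mono.mono Set.Ioo_subset_Ico_self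
  have hσm := aemeasurable_restrict_of_monotoneOn (μ := volume) measurableSet_Ioo hσ'
  set Q := quantileFn P (fun ω => ‖Y ω‖) with hQdef
  have hQmono : MonotoneOn Q (Set.Ioo 0 1) := quantileFn_monotoneOn hY.norm.aemeasurable
  have hQ0 : ∀ u ∈ Set.Ioo (0 : ℝ) 1, 0 ≤ Q u := fun u hu =>
    quantileFn_nonneg (fun ω => norm_nonneg (Y ω)) hu.1
  have hσid : ∀ V, IsUniformRV P V →
      ProbabilityTheory.IdentDistrib (σ ∘ V) σ P (volume.restrict (Set.Ioo 0 1)) := fun V hV =>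
    hV.identDistrib_id.comp_of_aemeasurable (by rwa [hV.identDistrib_id.map_eq, Measure.map_id])
  have hQid : ProbabilityTheory.IdentDistrib (fun ω => ‖Y ω‖ ^ p) (fun u => Q u ^ p) P
      (volume.restrict (Set.Ioo 0 1)) :=
    (identDistrib_quantileFn hY.norm.aemeasurable).comp (u := fun x : ℝ => x ^ p) (by fun_prop)
  have hσ0 : ∀ V, IsUniformRV P V → 0 ≤ᵐ[P] σ ∘ V := fun V hV => by
    filter_upwards [hV.ae_mem_Ioo] with ω hω
    exact hσ.nonneg _ (Set.Ioo_subset_Ico_self hω)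
  have hY0 : 0 ≤ᵐ[P] fun ω => ‖Y ω‖ ^ p := .of_forall fun ω => by positivity
  have hE : ∀ V : Ω → ℝ, ∫⁻ ω, ENNReal.ofReal (σ (V ω)) * (‖Y ω‖₊ : ℝ≥0∞) ^ p ∂P
      = ∫⁻ ω, ENNReal.ofReal ((σ ∘ V) ω) * ENNReal.ofReal (‖Y ω‖ ^ p) ∂P := fun V => by
    refine lintegral_congr fun ω => ?_
    rw [← ENNReal.ofReal_rpow_of_nonneg (norm_nonneg _) hp0, ofReal_norm]
    rfl
  have hI : ∫⁻ u in Set.Ioo (0 : ℝ) 1, ENNReal.ofReal (σ u) * ENNReal.ofReal (Q u) ^ p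
      = ∫⁻ u in Set.Ioo (0 : ℝ) 1, ENNReal.ofReal (σ u) * ENNReal.ofReal (Q u ^ p) := by
    refine setLIntegral_congr_fun measurableSet_Ioo fun u hu => ?_
    simp only [ENNReal.ofReal_rpow_of_nonneg (hQ0 u hu) hp0]
  have hle : ∀ V, IsUniformRV P V →
      ∫⁻ ω, ENNReal.ofReal (σ (V ω)) * (‖Y ω‖₊ : ℝ≥0∞) ^ p ∂P
        ≤ ∫⁻ u in Set.Ioo (0 : ℝ) 1, ENNReal.ofReal (σ u) * ENNReal.ofReal (Q u) ^ p := by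
    intro V hV
    rw [hE, hI]
    refine lintegral_ofReal_mul_le_of_comonotone (hσid V hV) hQid (hσ0 V hV) hY0 ?_
    filter_upwards [Measure.quasiMeasurePreserving_fst.ae (ae_restrict_mem measurableSet_Ioo),
      Measure.quasiMeasurePreserving_snd.ae (ae_restrict_mem measurableSet_Ioo)] with z h1 h2
    rintro ⟨h, h'⟩
    have hlt := hσ'.reflect_lt h1 h2 h
    exact h'.not_ge (Real.rpow_le_rpow (hQ0 _ h1) (hQmono h1 h2 hlt.le) hp0)
  have hge : ∫⁻ u in Set.Ioo (0 : ℝ) 1, ENNReal.ofReal (σ u) * ENNReal.ofReal (Q u) ^ p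
      ≤ ∫⁻ ω, ENNReal.ofReal (σ (U ω)) * (‖Y ω‖₊ : ℝ≥0∞) ^ p ∂P := by
    rw [hE, hI]
    refine lintegral_ofReal_mul_le_of_comonotone (hσid U hU).symm hQid.symm
      ((hσid U hU).ae_snd (measurableSet_Ici (a := (0 : ℝ))) (hσ0 U hU))
      (hQid.ae_snd (measurableSet_Ici (a := (0 : ℝ))) hY0) ?_
    filter_upwards [hcom, Measure.quasiMeasurePreserving_fst.ae hU.ae_mem_Ioo,
      Measure.quasiMeasurePreserving_snd.ae hU.ae_mem_Ioo] with z hz h1 h2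
    rintro ⟨h, h'⟩
    have hlt : U z.1 < U z.2 := hσ'.reflect_lt h1 h2 h
    have hlt' : ‖Y z.2‖ < ‖Y z.1‖ := lt_of_not_ge fun h'' =>
      h'.not_ge (Real.rpow_le_rpow (norm_nonneg _) h'' hp0)
    exact hz.not_gt (mul_neg_of_neg_of_pos (sub_neg.2 hlt) (sub_pos.2 hlt'))
  have hsup : sigmaPow P σ p Y
      = ∫⁻ u in Set.Ioo (0 : ℝ) 1, ENNReal.ofReal (σ u) * ENNReal.ofReal (Q u) ^ p :=
    le_antisymm (iSup₂_le hle) (hge.trans (le_iSup₂_of_le U hU le_rfl))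
  exact ⟨hsup.trans (hge.antisymm (hle U hU)), hsup⟩

end
end

section
/- Let σ be a distortion function, X a Banach space and p ∈ [1,∞). Then the simple functions (finitely valued strongly measurable functions Ω → X) are dense in L_σ^p(P,X) with respect to the norm ‖·‖_{σ,p}. -/
open MeasureTheory
open scoped ENNReal NNReal

noncomputable section

variable {Ω : Type*} [MeasurableSpace Ω]

open Filter Topology Set in
/-- A finite measure on the line has quantiles. -/
lemma exists_quantile (μ : Measure ℝ) [IsFiniteMeasure μ] {u : ℝ} (h0 : 0 < u)
    (h1 : u < μ.real univ) : ∃ x, μ.real (Iio x) ≤ u ∧ u ≤ μ.real (Iic x) := by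
  have hanti : ∀ s : ℕ → ℝ, Antitone s →
      Tendsto (fun n => μ.real (Iic (s n))) atTop (𝓝 (μ.real (⋂ n, Iic (s n)))) := fun s hs =>
    (ENNReal.tendsto_toReal (measure_ne_top μ _)).comp
      (tendsto_measure_iInter_atTop (fun _ => measurableSet_Iic.nullMeasurableSet)
        (fun i j hij => Iic_subset_Iic.2 (hs hij)) ⟨0, measure_ne_top μ _⟩)
  have hmono : ∀ s : ℕ → ℝ, Monotone s →
      Tendsto (fun n => μ.real (Iic (s n))) atTop (𝓝 (μ.real (⋃ n, Iic (s n)))) := fun s hs =>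
    (ENNReal.tendsto_toReal (measure_ne_top μ _)).comp
      (tendsto_measure_iUnion_atTop (fun i j hij => Iic_subset_Iic.2 (hs hij)))
  set S : Set ℝ := {q | u ≤ μ.real (Iic q)} with hS
  have hne : S.Nonempty := by
    have h := hmono (fun n => (n : ℝ)) Nat.mono_cast
    have e : ⋃ n : ℕ, Iic (n : ℝ) = univ :=
      eq_univ_of_forall fun x => mem_iUnion.2 (exists_nat_ge x)
    rw [e] at h
    obtain ⟨n, hn⟩ := (h.eventually (lt_mem_nhds h1)).exists
    exact ⟨n, hn.le⟩
  have hbdd : BddBelow S := by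
    have h := hanti (fun n => -(n : ℝ)) (fun i j hij => neg_le_neg (Nat.mono_cast hij))
    have e : ⋂ n : ℕ, Iic (-(n : ℝ)) = ∅ := by
      refine eq_empty_of_forall_notMem fun x hx => ?_
      obtain ⟨n, hn⟩ := exists_nat_gt (-x)
      have := mem_Iic.1 (mem_iInter.1 hx n)
      linarith
    rw [e, measureReal_empty] at h
    obtain ⟨n, hn⟩ := (h.eventually (gt_mem_nhds h0)).exists
    refine ⟨-(n : ℝ), fun q hq => ?_⟩
    by_contra! hlt
    exact absurd (hq.trans (measureReal_mono (Iic_subset_Iic.2 hlt.le))) (not_le.2 hn)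
  refine ⟨sInf S, ?_, ?_⟩
  · obtain ⟨s, hs, hlt, hlim⟩ := exists_seq_strictMono_tendsto (sInf S)
    have h := hmono s hs.monotone
    rw [iUnion_Iic_eq_Iio_of_lt_of_tendsto hlt hlim] at h
    refine le_of_tendsto' h fun n => ?_
    by_contra! hn
    exact absurd (csInf_le hbdd (show s n ∈ S from hn.le)) (not_le.2 (hlt n))
  · obtain ⟨s, hs, hlt, hlim⟩ := exists_seq_strictAnti_tendsto (sInf S)
    have h := hanti s hs.antitone
    have e : ⋂ n, Iic (s n) = Iic (sInf S) := by
      ext y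
      simp only [mem_iInter, mem_Iic]
      exact ⟨fun hy => ge_of_tendsto' hlim hy, fun hy n => hy.trans (hlt n).le⟩
    rw [e] at h
    refine ge_of_tendsto' h fun n => ?_
    obtain ⟨q, hq, hqs⟩ := exists_lt_of_csInf_lt hne (hlt n)
    exact le_trans hq (measureReal_mono (Iic_subset_Iic.2 hqs.le))

open Set in
lemma le_measureReal_cdf_le (ν : Measure ℝ) [IsFiniteMeasure ν] [NullSingletonClass ν] {s : ℝ}
    (h0 : 0 ≤ s) (h1 : s ≤ ν.real univ) : s ≤ ν.real {y | ν.real (Iic y) ≤ s} := by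
  rcases h0.eq_or_lt with rfl | h0
  · exact measureReal_nonneg
  rcases h1.eq_or_lt with rfl | h1
  · exact measureReal_mono fun y _ => measureReal_mono (subset_univ _)
  obtain ⟨x, hx, hx'⟩ := exists_quantile ν h0 h1
  have e : ν.real (Iio x) = ν.real (Iic x) := measureReal_congr Iio_ae_eq_Iic
  exact hx'.trans (measureReal_mono fun y hy =>
    (measureReal_mono (Iic_subset_Iic.2 hy)).trans (e ▸ hx))

open Set in
lemma measureReal_cdf_lt_le (ν : Measure ℝ) [IsFiniteMeasure ν] {s : ℝ}
    (h0 : 0 ≤ s) (h1 : s ≤ ν.real univ) : ν.real {y | ν.real (Iic y) < s} ≤ s := by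
  rcases h0.eq_or_lt with rfl | h0
  · have : {y | ν.real (Iic y) < 0} = ∅ :=
      eq_empty_of_forall_notMem fun y hy => not_lt.2 measureReal_nonneg hy
    simp [this]
  rcases h1.eq_or_lt with rfl | h1
  · exact measureReal_mono (subset_univ _)
  obtain ⟨x, hx, hx'⟩ := exists_quantile ν h0 h1
  refine le_trans (measureReal_mono fun y hy => ?_) hx
  by_contra! hxy
  exact absurd (hx'.trans (measureReal_mono (Iic_subset_Iic.2 (not_lt.1 hxy)))) (not_le.2 hy)

open Set in
lemma IsUniformRV.map_eq {P : Measure Ω} [IsProbabilityMeasure P] {U : Ω → ℝ}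
    (hU : IsUniformRV P U) : P.map U = volume.restrict (Icc 0 1) := by
  obtain ⟨hm, hr, hu⟩ := hU
  refine Measure.ext_of_Iic _ _ fun a => ?_
  rw [Measure.map_apply hm measurableSet_Iic, Measure.restrict_apply measurableSet_Iic]
  rcases lt_or_ge a 0 with ha | ha
  · have h1 : U ⁻¹' Iic a = ∅ :=
      eq_empty_of_forall_notMem fun ω hω => not_lt.2 ((hr ω).1.trans hω) ha
    have h2 : Iic a ∩ Icc (0 : ℝ) 1 = ∅ :=
      eq_empty_of_forall_notMem fun y hy => not_lt.2 (hy.2.1.trans hy.1) ha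
    simp [h1, h2]
  rcases le_or_gt a 1 with ha' | ha'
  · have h2 : Iic a ∩ Icc (0 : ℝ) 1 = Icc 0 a := by
      ext y; simp only [mem_inter_iff, mem_Iic, mem_Icc]
      exact ⟨fun h => ⟨h.2.1, h.1⟩, fun h => ⟨h.2, h.1, h.2.trans ha'⟩⟩
    rw [h2, Real.volume_Icc, sub_zero]
    exact hu a ⟨ha, ha'⟩
  · have h1 : U ⁻¹' Iic a = univ := eq_univ_of_forall fun ω => (hr ω).2.trans ha'.le
    have h2 : Iic a ∩ Icc (0 : ℝ) 1 = Icc 0 1 :=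
      inter_eq_right.2 fun y hy => hy.2.trans ha'.le
    simp [h1, h2]

open Set in
/-- Lexicographic ranks: a uniform random variable `V` that is a nondecreasing function of
`(g, U)` in the lexicographic order, hence comonotone with `g`. -/
lemma exists_isUniformRV_comonotone {P : Measure Ω} [IsProbabilityMeasure P] {U : Ω → ℝ}
    (hU : IsUniformRV P U) {g : Ω → ℝ} (hg : Measurable g) :
    ∃ V, IsUniformRV P V ∧ ∀ t ω, (g ω ≤ t → V ω ≤ P.real {ω | g ω ≤ t}) ∧
      (t < g ω → P.real {ω | g ω ≤ t} ≤ V ω) := by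
  have hUm := hU.1
  set I : Ω → Set Ω := fun ω => {ω' | g ω' < g ω ∨ g ω' = g ω ∧ U ω' ≤ U ω} with hI
  set V : Ω → ℝ := fun ω => P.real (I ω) with hV
  have hVm : Measurable V := by
    have hS : MeasurableSet {z : Ω × Ω | g z.2 < g z.1 ∨ g z.2 = g z.1 ∧ U z.2 ≤ U z.1} := by
      have hg1 : Measurable fun z : Ω × Ω => g z.1 := by fun_prop
      have hg2 : Measurable fun z : Ω × Ω => g z.2 := by fun_prop
      have hU1 : Measurable fun z : Ω × Ω => U z.1 := by fun_prop
      have hU2 : Measurable fun z : Ω × Ω => U z.2 := by fun_prop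
      exact (measurableSet_lt hg2 hg1).union
        ((measurableSet_eq_fun hg2 hg1).inter (measurableSet_le hU2 hU1))
    exact (measurable_measure_prodMk_left (ν := P) hS).ennreal_toReal
  have hVr : ∀ ω, V ω ∈ Icc (0 : ℝ) 1 := fun ω => ⟨measureReal_nonneg, measureReal_le_one⟩
  have hle : ∀ t ω, g ω ≤ t → V ω ≤ P.real {ω | g ω ≤ t} := fun t ω h =>
    measureReal_mono fun ω' hω' => by
      rcases hω' with h' | h'
      · exact h'.le.trans h
      · exact h'.1.le.trans h
  have hge : ∀ t ω, t < g ω → P.real {ω | g ω ≤ t} ≤ V ω := fun t ω h =>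
    measureReal_mono fun ω' hω' => Or.inl (lt_of_le_of_lt hω' h)
  have hsplit : ∀ u, 0 < u → u < 1 →
      P.real {ω | V ω < u} ≤ u ∧ u ≤ P.real {ω | V ω ≤ u} := by
    intro u h0 h1
    obtain ⟨x, hx, hx'⟩ := exists_quantile (P.map g) h0 (by
      rw [map_measureReal_apply hg MeasurableSet.univ]; simpa using h1)
    rw [map_measureReal_apply hg measurableSet_Iio] at hx
    rw [map_measureReal_apply hg measurableSet_Iic] at hx'
    set ν : Measure ℝ := (P.restrict (g ⁻¹' {x})).map U with hν
    have hatom : NullSingletonClass ν := ⟨fun y => by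
      have h := congrArg (fun μ : Measure ℝ => μ {y}) hU.map_eq
      simp only [measure_singleton] at h
      refine le_antisymm (le_trans ?_ h.le) zero_le
      exact Measure.map_mono Measure.restrict_le_self hUm _⟩
    have hνr : ∀ A, MeasurableSet A → ν.real A = P.real (U ⁻¹' A ∩ g ⁻¹' {x}) := fun A hA => by
      rw [map_measureReal_apply hUm hA, measureReal_restrict_apply (hUm hA)]
    have hgx : MeasurableSet (g ⁻¹' {x}) := hg (measurableSet_singleton x)
    set s : ℝ := u - P.real (g ⁻¹' Iio x) with hs
    have hIic : P.real (g ⁻¹' Iic x) = P.real (g ⁻¹' Iio x) + P.real (g ⁻¹' {x}) := by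
      rw [← measureReal_union _ hgx, ← preimage_union, Iio_union_right]
      exact Disjoint.preimage g (by simp)
    have hs0 : 0 ≤ s := sub_nonneg.2 hx
    have hs1 : s ≤ ν.real univ := by
      rw [hνr _ MeasurableSet.univ, preimage_univ, univ_inter]; linarith
    have hVx : ∀ ω, g ω = x → V ω = P.real (g ⁻¹' Iio x) + ν.real (Iic (U ω)) := by
      intro ω hω
      rw [hνr _ measurableSet_Iic, ← measureReal_union _ ((hUm measurableSet_Iic).inter hgx)]
      · refine congrArg P.real (Set.ext fun ω' => ?_)
        simp only [hI, hω, mem_ofPred_eq, mem_union, mem_preimage, mem_Iio, mem_inter_iff, mem_Iic,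
          mem_singleton_iff, and_comm]
      · exact disjoint_left.2 fun ω' h h' => (ne_of_lt h) h'.2
    have hcdf : Measurable fun y => ν.real (Iic y) :=
      (show Monotone fun y => ν.real (Iic y) from
        fun a b hab => measureReal_mono (Iic_subset_Iic.2 hab)).measurable
    constructor
    · have hA := measurableSet_lt hcdf (measurable_const (a := s))
      have hb := measureReal_cdf_lt_le ν hs0 hs1
      rw [hνr _ hA] at hb
      have hsub : {ω | V ω < u} ⊆
          g ⁻¹' Iio x ∪ (U ⁻¹' {y | ν.real (Iic y) < s} ∩ g ⁻¹' {x}) := by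
        intro ω hω
        rcases lt_trichotomy (g ω) x with h | h | h
        · exact Or.inl h
        · refine Or.inr ⟨?_, h⟩
          have := hVx ω h
          simp only [mem_ofPred_eq, mem_preimage] at hω ⊢
          linarith
        · exact absurd (hx'.trans (hge x ω h)) (not_le.2 hω)
      have := (measureReal_mono (μ := P) hsub).trans (measureReal_union_le _ _)
      linarith
    · have hA := measurableSet_le hcdf (measurable_const (a := s))
      have hb := le_measureReal_cdf_le ν hs0 hs1
      rw [hνr _ hA] at hb
      have hsub : g ⁻¹' Iio x ∪ (U ⁻¹' {y | ν.real (Iic y) ≤ s} ∩ g ⁻¹' {x}) ⊆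
          {ω | V ω ≤ u} := by
        rintro ω (h | ⟨h, hω⟩)
        · refine le_trans (measureReal_mono fun ω' hω' => ?_) hx
          rcases hω' with h' | h'
          · exact h'.trans h
          · exact h'.1.trans_lt h
        · have := hVx ω hω
          simp only [mem_ofPred_eq, mem_preimage] at h ⊢
          linarith
      have h2 := measureReal_mono (μ := P) hsub
      rw [measureReal_union _ ((hUm hA).inter hgx)] at h2
      · linarith
      · exact disjoint_left.2 fun ω' h h' => (ne_of_lt h) h'.2
  refine ⟨V, ⟨hVm, hVr, fun u hu => ?_⟩, fun t ω => ⟨hle t ω, hge t ω⟩⟩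
  rw [← ofReal_measureReal]
  congr 1
  rcases hu.2.eq_or_lt with rfl | h1
  · have : {ω | V ω ≤ 1} = univ := eq_univ_of_forall fun ω => (hVr ω).2
    simp [this]
  refine le_antisymm (le_of_forall_gt_imp_ge_of_dense fun v hv => ?_) ?_
  · rcases lt_or_ge v 1 with hv1 | hv1
    · exact (measureReal_mono fun ω (h : V ω ≤ u) => h.trans_lt hv).trans
        (hsplit v (hu.1.trans_lt hv) hv1).1
    · exact measureReal_le_one.trans hv1
  · rcases hu.1.eq_or_lt with rfl | h0
    · exact measureReal_nonneg
    · exact (hsplit u h0 h1).2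

/-- The extension of a distortion function to a monotone function on the whole line, with
value `0` to the left of `0` and `∞` from `1` on. -/
def distortionExt (σ : ℝ → ℝ) (u : ℝ) : ℝ≥0∞ :=
  if u < 0 then 0 else if u < 1 then ENNReal.ofReal (σ u) else ∞

lemma IsDistortion.monotone_ext {σ : ℝ → ℝ} (hσ : IsDistortion σ) :
    Monotone (distortionExt σ) := by
  intro a b hab
  unfold distortionExt
  by_cases ha : a < 0
  · simp [ha]
  have hb : ¬ b < 0 := fun h => ha (hab.trans_lt h)
  by_cases hb1 : b < 1
  · have ha1 : a < 1 := hab.trans_lt hb1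
    simp only [ha, hb, ha1, hb1, if_true, if_false]
    exact ENNReal.ofReal_le_ofReal (hσ.mono ⟨not_lt.1 ha, ha1⟩ ⟨not_lt.1 hb, hb1⟩ hab)
  · simp [hb, hb1]

lemma distortionExt_eq (σ : ℝ → ℝ) {u : ℝ} (h0 : 0 ≤ u) (h1 : u < 1) :
    distortionExt σ u = ENNReal.ofReal (σ u) := by
  simp [distortionExt, not_lt.2 h0, h1]

lemma ae_distortionExt_eq (σ : ℝ → ℝ) :
    ∀ᵐ u ∂volume.restrict (Set.Icc (0 : ℝ) 1), distortionExt σ u = ENNReal.ofReal (σ u) := by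
  have h1 : ∀ᵐ u ∂volume.restrict (Set.Icc (0 : ℝ) 1), u ≠ 1 :=
    compl_mem_ae_iff.2 (measure_singleton 1)
  filter_upwards [h1, ae_restrict_mem measurableSet_Icc] with u hu hu'
  exact distortionExt_eq σ hu'.1 (lt_of_le_of_ne hu'.2 hu)

lemma IsDistortion.lintegral_ext {σ : ℝ → ℝ} (hσ : IsDistortion σ) :
    ∫⁻ u in Set.Icc (0 : ℝ) 1, distortionExt σ u = 1 := by
  have hint : IntegrableOn σ (Set.Ioo 0 1) := by
    by_contra h
    exact zero_ne_one ((integral_undef h).symm.trans hσ.integral_one)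
  rw [lintegral_congr_ae (ae_distortionExt_eq σ), ← setLIntegral_congr Ioo_ae_eq_Icc,
    ← ofReal_integral_eq_lintegral_ofReal hint, hσ.integral_one, ENNReal.ofReal_one]
  filter_upwards [ae_restrict_mem measurableSet_Ioo] with u hu
  exact hσ.nonneg u ⟨hu.1.le, hu.2⟩

lemma IsUniformRV.lintegral_comp {P : Measure Ω} [IsProbabilityMeasure P] {U : Ω → ℝ}
    (hU : IsUniformRV P U) {f : ℝ → ℝ≥0∞} (hf : Measurable f) :
    ∫⁻ ω, f (U ω) ∂P = ∫⁻ u in Set.Icc (0 : ℝ) 1, f u := by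
  rw [← hU.map_eq, lintegral_map hf hU.1]

lemma IsUniformRV.lintegral_distortion_mul {P : Measure Ω} [IsProbabilityMeasure P] {U : Ω → ℝ}
    (hU : IsUniformRV P U) (σ : ℝ → ℝ) (f : Ω → ℝ≥0∞) :
    ∫⁻ ω, ENNReal.ofReal (σ (U ω)) * f ω ∂P = ∫⁻ ω, distortionExt σ (U ω) * f ω ∂P := by
  have h := ae_distortionExt_eq σ
  rw [← hU.map_eq] at h
  refine lintegral_congr_ae ?_
  filter_upwards [ae_of_ae_map hU.1.aemeasurable h] with ω hω
  rw [hω]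

/-- Among all uniform random variables, one that is large exactly on `A` maximizes
the distorted mass of `A`. -/
lemma setLIntegral_comp_uniform_le {P : Measure Ω} [IsProbabilityMeasure P] {U V : Ω → ℝ}
    (hU : IsUniformRV P U) (hV : IsUniformRV P V) {τ : ℝ → ℝ≥0∞} (hτ : Measurable τ)
    {A : Set Ω} (hA : MeasurableSet A) {c : ℝ≥0∞} (hc : ∀ ω ∈ A, c ≤ τ (V ω))
    (hc' : ∀ ω ∉ A, τ (V ω) ≤ c) :
    ∫⁻ ω in A, τ (U ω) ∂P ≤ ∫⁻ ω in A, τ (V ω) ∂P := by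
  have hm : Measurable fun u => τ u - c := hτ.sub_const c
  calc ∫⁻ ω in A, τ (U ω) ∂P ≤ ∫⁻ ω in A, (c + (τ (U ω) - c)) ∂P :=
        lintegral_mono fun ω => le_add_tsub
    _ = c * P A + ∫⁻ ω in A, (τ (U ω) - c) ∂P := by
        rw [lintegral_add_left measurable_const, setLIntegral_const]
    _ ≤ c * P A + ∫⁻ ω, (τ (U ω) - c) ∂P := by
        gcongr; exact Measure.restrict_le_self
    _ = c * P A + ∫⁻ ω, (τ (V ω) - c) ∂P := by
        rw [hU.lintegral_comp hm, hV.lintegral_comp hm]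
    _ = c * P A + ∫⁻ ω in A, (τ (V ω) - c) ∂P := by
        congr 1
        rw [← lintegral_indicator hA]
        refine lintegral_congr fun ω => ?_
        by_cases h : ω ∈ A
        · simp [h]
        · simp [h, tsub_eq_zero_of_le (hc' ω h)]
    _ = ∫⁻ ω in A, (c + (τ (V ω) - c)) ∂P := by
        rw [lintegral_add_left measurable_const, setLIntegral_const]
    _ = ∫⁻ ω in A, τ (V ω) ∂P :=
        setLIntegral_congr_fun hA fun ω h => add_tsub_cancel_of_le (hc ω h)

open Set in
/-- Tail form of the rearrangement inequality: a uniform random variable comonotone with `g`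
maximizes the distorted expectation of `g` over each event `{K < g}`. -/
lemma setLIntegral_mul_le_of_comonotone {P : Measure Ω} [IsProbabilityMeasure P] {U V : Ω → ℝ}
    (hU : IsUniformRV P U) (hV : IsUniformRV P V) {τ : ℝ → ℝ≥0∞} (hτ : Monotone τ)
    {g : Ω → ℝ} (hg : Measurable g) (hg0 : ∀ ω, 0 ≤ g ω)
    (hVg : ∀ t ω, (g ω ≤ t → V ω ≤ P.real {ω | g ω ≤ t}) ∧
      (t < g ω → P.real {ω | g ω ≤ t} ≤ V ω)) (K : ℝ) :
    ∫⁻ ω in {ω | K < g ω}, τ (U ω) * ENNReal.ofReal (g ω) ∂P ≤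
      ∫⁻ ω in {ω | K < g ω}, τ (V ω) * ENNReal.ofReal (g ω) ∂P := by
  have hK : MeasurableSet {ω | K < g ω} := measurableSet_lt measurable_const hg
  have key : ∀ W : Ω → ℝ, Measurable W →
      ∫⁻ ω in {ω | K < g ω}, τ (W ω) * ENNReal.ofReal (g ω) ∂P =
        ∫⁻ t in Ioi (0 : ℝ), ∫⁻ ω in {ω | max t K < g ω}, τ (W ω) ∂P := by
    intro W hW
    have hm : Measurable fun ω => τ (W ω) := hτ.measurable.comp hW
    have := lintegral_withDensity_eq_lintegral_mul (P.restrict {ω | K < g ω}) hm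
      hg.ennreal_ofReal
    refine this.symm.trans ?_
    rw [lintegral_eq_lintegral_meas_lt _ (Filter.Eventually.of_forall hg0) hg.aemeasurable]
    refine lintegral_congr fun t => ?_
    have ht : MeasurableSet {ω | t < g ω} := measurableSet_lt measurable_const hg
    rw [withDensity_apply _ ht, Measure.restrict_restrict ht]
    congr 2
    ext ω
    simp
  rw [key U hU.1, key V hV.1]
  refine lintegral_mono fun t => setLIntegral_comp_uniform_le hU hV hτ.measurable
    (measurableSet_lt measurable_const hg) (c := τ (P.real {ω | g ω ≤ max t K}))
    (fun ω hω => hτ ((hVg _ ω).2 hω)) (fun ω hω => hτ ((hVg _ ω).1 (not_lt.1 hω)))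

open Filter Topology in
lemma tendsto_lintegral_tsub_natCast {α : Type*} [MeasurableSpace α] {μ : Measure α}
    {f : α → ℝ≥0∞} (hf : Measurable f) (hfi : ∫⁻ a, f a ∂μ ≠ ∞) :
    Tendsto (fun m : ℕ => ∫⁻ a, (f a - m) ∂μ) atTop (𝓝 0) := by
  have h := tendsto_lintegral_of_dominated_convergence (μ := μ)
    (F := fun (m : ℕ) a => f a - m) (f := fun _ => 0) f
    (fun m => hf.sub_const _) (fun m => Eventually.of_forall fun a => tsub_le_self) hfi ?_
  · simpa using h
  filter_upwards [ae_lt_top hf hfi] with a ha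
  obtain ⟨n, hn⟩ := ENNReal.exists_nat_gt ha.ne
  refine tendsto_const_nhds.congr' ?_
  filter_upwards [eventually_ge_atTop n] with m hm
  exact (tsub_eq_zero_of_le (hn.le.trans (by exact_mod_cast hm))).symm

open Filter Topology in
lemma tendsto_setLIntegral_natCast_lt {P : Measure Ω} {w : Ω → ℝ≥0∞} (hw : Measurable w)
    {g : Ω → ℝ} (hg : Measurable g) (hfin : ∫⁻ ω, w ω * ENNReal.ofReal (g ω) ∂P ≠ ∞) :
    Tendsto (fun n : ℕ => ∫⁻ ω in {ω | (n : ℝ) < g ω}, w ω * ENNReal.ofReal (g ω) ∂P)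
      atTop (𝓝 0) := by
  have hA : ∀ n : ℕ, MeasurableSet {ω | (n : ℝ) < g ω} := fun n =>
    measurableSet_lt measurable_const hg
  have hm : Measurable fun ω => w ω * ENNReal.ofReal (g ω) := hw.mul hg.ennreal_ofReal
  have h := tendsto_lintegral_of_dominated_convergence (μ := P)
    (F := fun (n : ℕ) => {ω | (n : ℝ) < g ω}.indicator fun ω => w ω * ENNReal.ofReal (g ω))
    (f := fun _ => 0) (fun ω => w ω * ENNReal.ofReal (g ω)) (fun n => hm.indicator (hA n))
    (fun n => Eventually.of_forall fun ω => Set.indicator_le_self _ _ _) hfin ?_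
  · simpa only [lintegral_indicator (hA _), lintegral_zero] using h
  refine Eventually.of_forall fun ω => ?_
  obtain ⟨n, hn⟩ := exists_nat_ge (g ω)
  refine tendsto_const_nhds.congr' ?_
  filter_upwards [eventually_ge_atTop n] with m hm
  rw [Set.indicator_of_notMem]
  exact not_lt.2 (hn.trans (by exact_mod_cast hm))

/-- A bound on distorted expectations that depends on the uniform random variable only
through its law and through the tail of a majorant `g`. -/
lemma lintegral_mul_le_of_le_majorant {P : Measure Ω} [IsProbabilityMeasure P] {U : Ω → ℝ}
    (hU : IsUniformRV P U) {τ : ℝ → ℝ≥0∞} (hτ : Measurable τ) {g : Ω → ℝ} (hg : Measurable g)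
    {H : Ω → ℝ≥0∞} (hH : Measurable H) (hHg : ∀ ω, H ω ≤ ENNReal.ofReal (g ω))
    (K : ℕ) (M δ : ℝ≥0∞) :
    ∫⁻ ω, τ (U ω) * H ω ∂P ≤
      ∫⁻ ω in {ω | (K : ℝ) < g ω}, τ (U ω) * ENNReal.ofReal (g ω) ∂P +
        ((∫⁻ u in Set.Icc (0 : ℝ) 1, τ u) * δ + (K * M * P {ω | δ < H ω} +
          K * ∫⁻ u in Set.Icc (0 : ℝ) 1, (τ u - M))) := by
  have hA : MeasurableSet {ω | (K : ℝ) < g ω} := measurableSet_lt measurable_const hg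
  have hB : MeasurableSet {ω | δ < H ω} := measurableSet_lt measurable_const hH
  have hτU : Measurable fun ω => τ (U ω) := hτ.comp hU.1
  have hm : Measurable fun u => τ u - M := hτ.sub_const M
  have hτg : Measurable fun ω => τ (U ω) * ENNReal.ofReal (g ω) := hτU.mul hg.ennreal_ofReal
  rw [← hU.lintegral_comp hτ, ← hU.lintegral_comp hm, ← lintegral_indicator hA,
    ← lintegral_mul_const _ hτU, ← lintegral_const_mul _ (hτU.sub_const M),
    ← lintegral_indicator_const hB, ← lintegral_add_left (measurable_const.indicator hB),
    ← lintegral_add_left (hτU.mul_const δ),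
    ← lintegral_add_left (hτg.indicator hA)]
  refine lintegral_mono fun ω => ?_
  by_cases h1 : (K : ℝ) < g ω
  · rw [Set.indicator_of_mem (show ω ∈ {ω | (K : ℝ) < g ω} from h1)]
    exact (mul_le_mul_right (hHg ω) _).trans le_self_add
  by_cases h2 : δ < H ω
  · rw [Set.indicator_of_mem (show ω ∈ {ω | δ < H ω} from h2), ← mul_add]
    have hHK : H ω ≤ K := (hHg ω).trans (by
      simpa using ENNReal.ofReal_le_ofReal (not_lt.1 h1))
    calc τ (U ω) * H ω ≤ (M + (τ (U ω) - M)) * K := mul_le_mul' le_add_tsub hHK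
      _ = K * (M + (τ (U ω) - M)) := mul_comm _ _
      _ ≤ _ := le_add_self.trans le_add_self
  · exact (mul_le_mul_right (not_lt.1 h2) _).trans (le_self_add.trans le_add_self)

open Filter Topology in
/-- If `g` has a finite distorted expectation, then functions dominated by `g` that are small in
probability have small distorted expectation, uniformly over all uniform random variables. -/
lemma exists_forall_lintegral_mul_le {P : Measure Ω} [IsProbabilityMeasure P]
    (hrich : ∃ U : Ω → ℝ, IsUniformRV P U) {τ : ℝ → ℝ≥0∞} (hτ : Monotone τ)
    (hτ1 : ∫⁻ u in Set.Icc (0 : ℝ) 1, τ u = 1) {g : Ω → ℝ} (hg : Measurable g)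
    (hg0 : ∀ ω, 0 ≤ g ω)
    (hfin : ∀ V, IsUniformRV P V → ∫⁻ ω, τ (V ω) * ENNReal.ofReal (g ω) ∂P ≠ ∞)
    {δ : ℝ≥0∞} (hδ : 0 < δ) :
    ∃ c : ℝ≥0∞, 0 < c ∧ ∀ H : Ω → ℝ≥0∞, Measurable H → (∀ ω, H ω ≤ ENNReal.ofReal (g ω)) →
      P {ω | δ < H ω} ≤ c → ∀ U, IsUniformRV P U → ∫⁻ ω, τ (U ω) * H ω ∂P ≤ δ * 4 := by
  obtain ⟨U₀, hU₀⟩ := hrich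
  obtain ⟨V, hV, hVg⟩ := exists_isUniformRV_comonotone hU₀ hg
  have hτV : Measurable fun ω => τ (V ω) := hτ.measurable.comp hV.1
  obtain ⟨K, hK⟩ := ((tendsto_setLIntegral_natCast_lt hτV hg (hfin V hV)).eventually
    (gt_mem_nhds hδ)).exists
  obtain ⟨M, hM⟩ : ∃ M : ℕ, K * ∫⁻ u in Set.Icc (0 : ℝ) 1, (τ u - M) < δ := by
    have h := ENNReal.Tendsto.const_mul (a := (K : ℝ≥0∞))
      (tendsto_lintegral_tsub_natCast hτ.measurable (hτ1.trans_ne ENNReal.one_ne_top))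
      (Or.inr (ENNReal.natCast_ne_top K))
    rw [mul_zero] at h
    exact (h.eventually (gt_mem_nhds hδ)).exists
  obtain ⟨c, hc, hcδ⟩ := ENNReal.exists_nnreal_pos_mul_lt (a := K * M) (b := δ)
    (ENNReal.mul_ne_top (ENNReal.natCast_ne_top K) (ENNReal.natCast_ne_top M)) hδ.ne'
  refine ⟨c, by exact_mod_cast hc, fun H hH hHg hHc U hU => ?_⟩
  have hUK := (setLIntegral_mul_le_of_comonotone hU hV hτ hg hg0 hVg K).trans hK.le
  have hUH := lintegral_mul_le_of_le_majorant hU hτ.measurable hg hH hHg K M δ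
  have hKM : (K * M : ℝ≥0∞) * P {ω | δ < H ω} ≤ δ :=
    (mul_le_mul_right hHc _).trans ((mul_comm _ _).trans_le hcδ.le)
  rw [hτ1] at hUH
  calc ∫⁻ ω, τ (U ω) * H ω ∂P ≤ δ + (1 * δ + (δ + δ)) :=
        hUH.trans (add_le_add hUK (add_le_add le_rfl (add_le_add hKM hM.le)))
    _ = δ * 4 := by ring

open Filter Topology in
lemma exists_simpleFunc_enorm_sub_le {P : Measure Ω} [IsFiniteMeasure P] {X : Type*}
    [NormedAddCommGroup X] {Y : Ω → X} (hY : StronglyMeasurable Y) {r c : ℝ≥0∞} (hr : 0 < r)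
    (hc : 0 < c) :
    ∃ Z : SimpleFunc Ω X, (∀ ω, ‖Y ω - Z ω‖ₑ ≤ ‖Y ω‖ₑ) ∧ P {ω | r ≤ ‖Y ω - Z ω‖ₑ} < c := by
  borelize X
  have := hY.separableSpace_range_union_singleton (b := 0)
  set Z := fun n => SimpleFunc.approxOn Y hY.measurable (Set.range Y ∪ {0}) 0 (by simp) n with hZ
  have hlim : ∀ ω, Tendsto (fun n => Z n ω) atTop (𝓝 (Y ω)) := fun ω =>
    SimpleFunc.tendsto_approxOn hY.measurable (by simp) (subset_closure (by simp))
  have hmeas := tendstoInMeasure_of_tendsto_ae (μ := P)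
    (fun n => (Z n).stronglyMeasurable.aestronglyMeasurable) (Eventually.of_forall hlim) r hr
  obtain ⟨n, hn⟩ := (hmeas.eventually (gt_mem_nhds hc)).exists
  refine ⟨Z n, fun ω => ?_, ?_⟩
  · have := SimpleFunc.edist_approxOn_le hY.measurable (s := Set.range Y ∪ {0}) (y₀ := 0)
      (by simp) ω n
    rwa [edist_comm, edist_eq_enorm_sub, edist_comm, edist_zero_right] at this
  · simpa only [edist_comm, edist_eq_enorm_sub] using hn

/-- Simple functions are dense in `L_σ^p(P,X)`. -/
theorem statement7
    (P : Measure Ω) [IsProbabilityMeasure P]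
    (hrich : ∃ U : Ω → ℝ, IsUniformRV P U)
    {X : Type*} [NormedAddCommGroup X]
    (σ : ℝ → ℝ) (hσ : IsDistortion σ) (p : ℝ) (hp : 1 ≤ p)
    (Y : Ω → X) (hY : MemLsigma P σ p Y)
    (ε : ℝ≥0∞) (hε : 0 < ε) :
    ∃ Ys : SimpleFunc Ω X, sigmaNorm P σ p (fun ω => Y ω - Ys ω) < ε := by
  have hp0 : 0 < p := zero_lt_one.trans_le hp
  obtain ⟨⟨Y', hY', hYY'⟩, hfin⟩ := hY
  set τ := distortionExt σ
  have hτ : Monotone τ := hσ.monotone_ext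
  have hτ1 : ∫⁻ u in Set.Icc (0 : ℝ) 1, τ u = 1 := hσ.lintegral_ext
  set g : Ω → ℝ := fun ω => ‖Y' ω‖ ^ p
  have hg : Measurable g := hY'.norm.measurable.pow_const p
  have hg0 : ∀ ω, 0 ≤ g ω := fun ω => Real.rpow_nonneg (norm_nonneg _) p
  have hgY : ∀ ω, ENNReal.ofReal (g ω) = ‖Y' ω‖ₑ ^ p := fun ω => by
    rw [← ENNReal.ofReal_rpow_of_nonneg (norm_nonneg _) hp0.le, ofReal_norm]
  have hgfin : ∀ V, IsUniformRV P V → ∫⁻ ω, τ (V ω) * ENNReal.ofReal (g ω) ∂P ≠ ∞ := by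
    intro V hV
    rw [← hV.lintegral_distortion_mul]
    refine (lt_of_le_of_lt ?_ hfin).ne
    refine le_trans (le_of_eq (lintegral_congr_ae ?_)) (le_iSup₂ (f := fun U _ =>
      ∫⁻ ω, ENNReal.ofReal (σ (U ω)) * (‖Y ω‖₊ : ℝ≥0∞) ^ p ∂P) V hV)
    filter_upwards [hYY'] with ω hω
    rw [hgY, hω, enorm_eq_nnnorm]
  obtain ⟨δ, hδ, hδε⟩ := ENNReal.exists_nnreal_pos_mul_lt (a := 4) (b := ε ^ p) (by simp)
    (ENNReal.rpow_pos_of_nonneg hε hp0.le).ne'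
  have hδ' : (0 : ℝ≥0∞) < δ := by exact_mod_cast hδ
  obtain ⟨c, hc, hcH⟩ := exists_forall_lintegral_mul_le hrich hτ hτ1 hg hg0 hgfin hδ'
  obtain ⟨Z, hZ, hZc⟩ := exists_simpleFunc_enorm_sub_le (P := P) hY'
    (r := (δ : ℝ≥0∞) ^ (1 / p)) (c := c)
    (ENNReal.rpow_pos_of_nonneg hδ' (by positivity)) hc
  set H : Ω → ℝ≥0∞ := fun ω => ‖Y' ω - Z ω‖ₑ ^ p
  have hH : Measurable H := (hY'.sub Z.stronglyMeasurable).enorm.pow_const p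
  have hHg : ∀ ω, H ω ≤ ENNReal.ofReal (g ω) := fun ω => by
    rw [hgY]; exact ENNReal.rpow_le_rpow (hZ ω) hp0.le
  have hHc : P {ω | δ < H ω} ≤ c := by
    refine (measure_mono fun ω hω => ?_).trans hZc.le
    rw [Set.mem_ofPred_eq, one_div, ENNReal.rpow_inv_le_iff hp0]
    exact le_of_lt hω
  refine ⟨Z, ?_⟩
  have hpow : sigmaPow P σ p (fun ω => Y ω - Z ω) ≤ δ * 4 := by
    refine iSup₂_le fun U hU => ?_
    calc ∫⁻ ω, ENNReal.ofReal (σ (U ω)) * (‖Y ω - Z ω‖₊ : ℝ≥0∞) ^ p ∂P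
        = ∫⁻ ω, ENNReal.ofReal (σ (U ω)) * H ω ∂P := by
          refine lintegral_congr_ae ?_
          filter_upwards [hYY'] with ω hω
          rw [hω, ← enorm_eq_nnnorm]
      _ = ∫⁻ ω, τ (U ω) * H ω ∂P := hU.lintegral_distortion_mul σ H
      _ ≤ δ * 4 := hcH H hH hHg hHc U hU
  calc sigmaNorm P σ p (fun ω => Y ω - Z ω) < (ε ^ p) ^ (1 / p) :=
        ENNReal.rpow_lt_rpow (hpow.trans_lt hδε) (by positivity)
    _ = ε := by rw [← ENNReal.rpow_mul, mul_one_div_cancel hp0.ne', ENNReal.rpow_one]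

end
end
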